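/- For every integer m ≥ 0, the number of positions i with 1 ≤ i ≤ f_m at which a cube begins in the Fibonacci word F (i.e., for which there exists a nonempty word w with F[i; 3|w|] = www) equals f_{2k} − k² − k − 1 if m = 2k is even, and equals f_{2k+1} − k² − 2k − 2 if m = 2k+1 is odd. -/

import Mathlib

/-- Fibonacci numbers: `fn 0 = 1`, `fn 1 = 2`, `fn (m+2) = fn (m+1) + fn m`
(so `fn m` is the paper's `f_m`; also `f_{m-1} = Nat.fib (m+1)` etc.). -/
def fn (m : ℕ) : ℕ := Nat.fib (m + 2)

/-- Finite Fibonacci words `Fw m = σ^m(a)` for the morphism σ(a)=ab, σ(b)=a,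
with `a := false`, `b := true`; equivalently `Fw (m+2) = Fw (m+1) ++ Fw m`. -/
def Fw : ℕ → List Bool
  | 0 => [false]
  | 1 => [false, true]
  | m + 2 => Fw (m + 1) ++ Fw m

/-- The infinite Fibonacci word (0-indexed): the fixed point of σ beginning with `a`. -/
def fibWord (i : ℕ) : Bool := (Fw (i + 1)).getD i false

/-- `fFactor i n = F[i;n]`, the factor of length `n` of the Fibonacci word
beginning at (1-indexed) position `i`. -/
def fFactor (i n : ℕ) : List Bool := (List.range n).map fun t => fibWord (i - 1 + t)

/-- `w` occurs as a factor of the infinite Fibonacci word. -/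
def IsFactorF (w : List Bool) : Prop := ∃ i : ℕ, 1 ≤ i ∧ w = fFactor i w.length

/-- `D2 i n`: the number of distinct squares occurring as factors of `F[i;n]`. -/
noncomputable def D2 (i n : ℕ) : ℕ :=
  {w : List Bool | w ≠ [] ∧ (w ++ w) <:+: fFactor i n}.ncard

/-! ### The Fibonacci word as a fixed point -/

/-- The morphism on letters. -/
def sg (c : Bool) : List Bool := if c then [false] else [false, true]

lemma Fw_succ (m : ℕ) : Fw (m + 1) = (Fw m).flatMap sg := by
  induction m using Nat.strong_induction_on with
  | _ m ih =>
    match m with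
    | 0 => rfl
    | 1 => rfl
    | m + 2 =>
      have h1 := ih (m + 1) (by omega)
      have h2 := ih m (by omega)
      rw [Fw, h1, h2, ← List.flatMap_append, ← h2]
      congr 1

lemma Fw_pre_succ (m : ℕ) : Fw m <+: Fw (m + 1) := by
  cases m with
  | zero => exact ⟨[true], rfl⟩
  | succ m => exact ⟨Fw m, rfl⟩

lemma Fw_pre {m n : ℕ} (h : m ≤ n) : Fw m <+: Fw n := by
  induction n, h using Nat.le_induction with
  | base => exact List.prefix_refl _
  | succ n _ ih => exact ih.trans (Fw_pre_succ n)

lemma Fw_length (m : ℕ) : m < (Fw m).length := by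
  induction m using Nat.strong_induction_on with
  | _ m ih =>
    match m with
    | 0 => simp [Fw]
    | 1 => simp [Fw]
    | m + 2 =>
      have h1 := ih (m + 1) (by omega)
      have h2 := ih m (by omega)
      rw [Fw, List.length_append]
      omega

lemma fibWord_eq {m i : ℕ} (h : i < (Fw m).length) : fibWord i = (Fw m)[i] := by
  have h1 : i < (Fw (i + 1)).length := by have := Fw_length (i + 1); omega
  have e : fibWord i = (Fw (i + 1))[i] := by simp [fibWord, h1]
  rw [e]
  rcases le_total m (i + 1) with hm | hm
  · exact ((Fw_pre hm).getElem h).symm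
  · exact (Fw_pre hm).getElem h1

/-- `Tp n` is the length of the image of the prefix of length `n` under the morphism. -/
def Tp : ℕ → ℕ
  | 0 => 0
  | n + 1 => Tp n + (if fibWord n then 1 else 2)

lemma Tp_eq {m n : ℕ} (h : n ≤ (Fw m).length) :
    Tp n = (((Fw m).take n).flatMap sg).length := by
  induction n with
  | zero => simp [Tp]
  | succ n ih =>
    have hn : n < (Fw m).length := h
    rw [Tp, ih (by omega), List.take_succ_eq_append_getElem hn, List.flatMap_append,
      List.length_append, fibWord_eq hn]
    cases (Fw m)[n] <;> simp [sg]

lemma Fw_split {m n : ℕ} (h : n < (Fw m).length) :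
    Fw (m + 1) = ((Fw m).take n).flatMap sg ++ (sg (fibWord n) ++ ((Fw m).drop (n + 1)).flatMap sg) := by
  have e : Fw m = (Fw m).take n ++ (Fw m)[n] :: (Fw m).drop (n + 1) := by
    rw [← List.drop_eq_getElem_cons h, List.take_append_drop]
  rw [Fw_succ, fibWord_eq h]
  have e2 := congrArg (List.flatMap sg) e
  rwa [List.flatMap_append, List.flatMap_cons] at e2

lemma F_Tp (n : ℕ) : fibWord (Tp n) = false := by
  have h := Fw_length n
  have e := Fw_split h
  have t := Tp_eq h.le
  have hl : Tp n < (Fw (n + 1)).length := by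
    rw [e, List.length_append, ← t]
    cases fibWord n <;> simp [sg]
  rw [fibWord_eq hl]
  simp only [e, t]
  rw [List.getElem_append_right (by simp)]
  obtain ⟨tl, hsg⟩ : ∃ tl, sg (fibWord n) = false :: tl := by
    cases fibWord n
    · exact ⟨[true], rfl⟩
    · exact ⟨[], rfl⟩
  simp only [Nat.sub_self]
  simp [hsg]

lemma F_Tp_a {n : ℕ} (ha : fibWord n = false) : fibWord (Tp n + 1) = true := by
  have h := Fw_length n
  have e := Fw_split h
  have t := Tp_eq h.le
  rw [ha] at e
  have hl : Tp n + 1 < (Fw (n + 1)).length := by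
    rw [e, List.length_append, ← t]
    simp [sg]
  rw [fibWord_eq hl]
  simp only [e, t]
  rw [List.getElem_append_right (by simp)]
  simp [sg]

lemma Tp_a {n : ℕ} (h : fibWord n = false) : Tp (n + 1) = Tp n + 2 := by simp [Tp, h]
lemma Tp_b {n : ℕ} (h : fibWord n = true) : Tp (n + 1) = Tp n + 1 := by simp [Tp, h]

lemma F_ne_true {n : ℕ} : fibWord n ≠ true ↔ fibWord n = false := by simp

lemma Tp_cases (N : ℕ) : ∃ n, N = Tp n ∨ (N = Tp n + 1 ∧ fibWord n = false) := by
  induction N with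
  | zero => exact ⟨0, Or.inl rfl⟩
  | succ N ih =>
    obtain ⟨n, h | ⟨h, ha⟩⟩ := ih
    · cases hn : fibWord n
      · exact ⟨n, Or.inr ⟨by omega, hn⟩⟩
      · exact ⟨n + 1, Or.inl (by rw [Tp_b hn]; omega)⟩
    · exact ⟨n + 1, Or.inl (by rw [Tp_a ha]; omega)⟩

lemma Tp_mono : StrictMono Tp := by
  refine strictMono_nat_of_lt_succ fun n => ?_
  cases h : fibWord n
  · rw [Tp_a h]; omega
  · rw [Tp_b h]; omega

lemma F0 : fibWord 0 = false := rfl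
lemma F1 : fibWord 1 = true := rfl
lemma F2 : fibWord 2 = false := rfl
lemma F3 : fibWord 3 = false := rfl
lemma F4 : fibWord 4 = true := rfl

/-- positions of letter `a` are the values of `Tp` -/
lemma a_is_Tp {N : ℕ} (h : fibWord N = false) : ∃ n, N = Tp n := by
  obtain ⟨n, h1 | ⟨h1, ha⟩⟩ := Tp_cases N
  · exact ⟨n, h1⟩
  · rw [h1, F_Tp_a ha] at h; cases h

lemma b_is_Tp {N : ℕ} (h : fibWord N = true) : ∃ n, N = Tp n + 1 ∧ fibWord n = false := by
  obtain ⟨n, h1 | h1⟩ := Tp_cases N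
  · rw [h1, F_Tp] at h; cases h
  · exact ⟨n, h1⟩

lemma b_next {N : ℕ} (h : fibWord N = true) : fibWord (N + 1) = false := by
  obtain ⟨n, h1, ha⟩ := b_is_Tp h
  have : N + 1 = Tp (n + 1) := by rw [Tp_a ha]; omega
  rw [this, F_Tp]

lemma b_prev {N : ℕ} (h : fibWord (N + 1) = true) : fibWord N = false := by
  obtain ⟨n, h1, ha⟩ := b_is_Tp h
  have : N = Tp n := by omega
  rw [this, F_Tp]

lemma b_pos {N : ℕ} (h : fibWord N = true) : 1 ≤ N := by
  rcases Nat.eq_zero_or_pos N with h0 | h0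
  · rw [h0, F0] at h; cases h
  · exact h0

lemma Tp_two (n : ℕ) : Tp n + 3 ≤ Tp (n + 2) := by
  cases h : fibWord n
  · have := Tp_a h
    have := Tp_mono (show n + 1 < n + 2 by omega)
    omega
  · have := Tp_b h
    have h2 : Tp (n + 2) = Tp (n + 1) + 2 := Tp_a (b_next h)
    omega

lemma Tp_Tp (n : ℕ) : Tp (Tp n) = Tp n + n := by
  induction n with
  | zero => rfl
  | succ n ih =>
    cases h : fibWord n
    · have h1 := Tp_a (F_Tp n)
      have h2 := Tp_b (F_Tp_a h)
      have h3 := Tp_a h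
      rw [h3, h2, h1]; omega
    · have h1 := Tp_a (F_Tp n)
      have h3 := Tp_b h
      rw [h3, h1]; omega

lemma T_fib (r : ℕ) : Tp (Nat.fib (r + 2)) = Nat.fib (r + 3) := by
  induction r with
  | zero => rfl
  | succ r ih =>
    have h : Nat.fib (r + 4) = Nat.fib (r + 2) + Nat.fib (r + 3) := Nat.fib_add_two
    have h2 := Tp_Tp (Nat.fib (r + 2))
    rw [ih] at h2
    rw [show r + 1 + 2 = r + 3 from rfl, show r + 1 + 3 = r + 4 from rfl]
    omega

/-! ### The mismatch sets -/

/-- `E j N`: a block `σ^(j+1)(a)` ends just before position `N`. -/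
def E (j N : ℕ) : Prop := ∃ m, fibWord m = true ∧ N = Tp^[j] (m + 1)

lemma E_zero (n : ℕ) : E 0 (n + 1) ↔ fibWord n = true := by
  constructor
  · rintro ⟨m, hm, h⟩
    simp at h
    rwa [h]
  · intro h; exact ⟨n, h, rfl⟩

lemma E_succ (j N : ℕ) : E (j + 1) N ↔ ∃ n, E j n ∧ N = Tp n := by
  constructor
  · rintro ⟨m, hm, h⟩
    exact ⟨_, ⟨m, hm, rfl⟩, by rw [h, Function.iterate_succ_apply']⟩
  · rintro ⟨n, ⟨m, hm, h⟩, h2⟩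
    exact ⟨m, hm, by rw [h2, h, Function.iterate_succ_apply']⟩

lemma E_succ_Tp (j n : ℕ) : E (j + 1) (Tp n) ↔ E j n := by
  rw [E_succ]
  constructor
  · rintro ⟨x, hx, h⟩
    rwa [Tp_mono.injective h]
  · intro h; exact ⟨n, h, rfl⟩

lemma E_nonadj (j n : ℕ) (h1 : E j n) (h2 : E j (n + 1)) : False := by
  cases j with
  | zero =>
    obtain ⟨m, hm, h⟩ := h1
    simp at h
    subst h
    rw [E_zero, b_next hm] at h2
    cases h2
  | succ j =>
    induction j generalizing n with
    | zero =>
      rw [E_succ] at h1 h2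
      obtain ⟨x, hx, h⟩ := h1
      obtain ⟨y, hy, h'⟩ := h2
      cases hb : fibWord x
      · have := Tp_a hb
        have h3 : Tp x < Tp y := by omega
        have h4 := Tp_mono.lt_iff_lt.1 h3
        have h5 := Tp_mono.monotone (show x + 1 ≤ y from h4)
        omega
      · obtain ⟨m, hm, hmx⟩ := hx
        simp at hmx
        subst hmx
        rw [b_next hm] at hb
        cases hb
    | succ j ih =>
      rw [E_succ] at h1 h2
      obtain ⟨x, hx, h⟩ := h1
      obtain ⟨y, hy, h'⟩ := h2
      have h3 : Tp x < Tp y := by omega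
      have h4 := Tp_mono.lt_iff_lt.1 h3
      have h5 : y = x + 1 := by
        by_contra hne
        have := Tp_mono.monotone (show x + 2 ≤ y by omega)
        have := Tp_two x
        omega
      subst h5
      exact ih x hx hy

open Classical in
/-- The defect of the shift by a Fibonacci number. -/
lemma shift_T (j n : ℕ) : (Tp (n + Nat.fib (j + 2)) : ℤ) =
    Tp n + Nat.fib (j + 3) - (if E j (n + 1) then (-1) ^ j else 0) := by
  induction j generalizing n with
  | zero =>
    rw [E_zero]
    cases h : fibWord n
    · have := Tp_a h
      simp [Nat.fib, this]
    · have := Tp_b h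
      simp [Nat.fib, this]
      omega
  | succ j ih =>
    have hf : Nat.fib (j + 4) = Nat.fib (j + 2) + Nat.fib (j + 3) := Nat.fib_add_two
    rw [show j + 1 + 2 = j + 3 from rfl, show j + 1 + 3 = j + 4 from rfl]
    -- general facts
    have key : ∀ x, E j (x + 1) → ((-1 : ℤ) ^ j = 1 ∧ fibWord x = true ∧ fibWord (x + Nat.fib (j + 2)) = false) ∨
        ((-1 : ℤ) ^ j = -1 ∧ fibWord x = false ∧ fibWord (x + Nat.fib (j + 2)) = true) := by
      intro x hx
      have hx2 : ¬ E j (x + 2) := fun h => E_nonadj j _ hx h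
      have e1 := ih x
      have e2 := ih (x + 1)
      rw [if_pos hx] at e1
      rw [if_neg hx2, show x + 1 + Nat.fib (j + 2) = x + Nat.fib (j + 2) + 1 by ring] at e2
      rcases neg_one_pow_eq_or ℤ j with hs | hs
      · left
        cases hA : fibWord x <;> cases hB : fibWord (x + Nat.fib (j + 2)) <;>
          simp only [hA, hB, Tp, hs] at e1 e2 ⊢ <;> push_cast at e1 e2 <;> simp at e1 e2 ⊢ <;> omega
      · right
        cases hA : fibWord x <;> cases hB : fibWord (x + Nat.fib (j + 2)) <;>
          simp only [hA, hB, Tp, hs] at e1 e2 ⊢ <;> push_cast at e1 e2 <;> simp at e1 e2 ⊢ <;> omega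
    obtain ⟨x, hN | ⟨hN, ha⟩⟩ := Tp_cases n
    · subst hN
      have e := ih x
      have tt := Tp_Tp x
      have tt2 := Tp_Tp (x + Nat.fib (j + 2))
      by_cases hx : E j (x + 1)
      · rw [if_pos hx] at e
        rcases key x hx with ⟨hs, hA, hB⟩ | ⟨hs, hA, hB⟩
        · have hE : E (j + 1) (Tp x + 1) := by
            rw [← Tp_b hA, E_succ_Tp]; exact hx
          rw [if_pos hE, pow_succ, hs]
          rw [hs] at e
          have hidx : Tp x + Nat.fib (j + 3) = Tp (x + Nat.fib (j + 2)) + 1 := by omega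
          rw [hidx, Tp_a (F_Tp _)]
          push_cast
          omega
        · have hE : ¬ E (j + 1) (Tp x + 1) := by
            rw [E_succ]
            rintro ⟨y, hy, h⟩
            have := F_Tp y
            rw [← h, F_Tp_a hA] at this
            cases this
          rw [if_neg hE]
          rw [hs] at e
          have hidx : Tp x + Nat.fib (j + 3) + 1 = Tp (x + Nat.fib (j + 2)) := by omega
          obtain ⟨z, hz⟩ : ∃ z, x + Nat.fib (j + 2) = z + 1 := ⟨x + Nat.fib (j + 2) - 1, by
            have := b_pos hB; omega⟩
          rw [hz] at hB tt2 hidx e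
          have hz' := b_prev hB
          have h1 := Tp_a hz'
          have h2 := Tp_b (F_Tp_a hz')
          rw [show Tp x + Nat.fib (j + 3) = Tp z + 1 by omega]
          rw [← h1] at h2
          omega
      · rw [if_neg hx] at e
        have hE : ¬ E (j + 1) (Tp x + 1) := by
          rw [E_succ]
          rintro ⟨y, hy, h⟩
          cases hA : fibWord x
          · have := F_Tp y
            rw [← h, F_Tp_a hA] at this
            cases this
          · rw [← Tp_b hA] at h
            rw [Tp_mono.injective h] at hx
            exact hx hy
        rw [if_neg hE, show Tp x + Nat.fib (j + 3) = Tp (x + Nat.fib (j + 2)) by omega]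
        omega
    · subst hN
      have e := ih x
      have tt := Tp_Tp x
      have tt2 := Tp_Tp (x + Nat.fib (j + 2))
      have hT := Tp_a (F_Tp x)
      have h1 : Tp x + 1 + 1 = Tp (x + 1) := by rw [Tp_a ha]
      rw [h1]
      simp only [E_succ_Tp]
      by_cases hx : E j (x + 1)
      · rw [if_pos hx] at e ⊢
        rcases key x hx with ⟨hs, hA, hB⟩ | ⟨hs, hA, hB⟩
        · rw [ha] at hA; cases hA
        · rw [hs] at e
          rw [pow_succ, hs, show Tp x + 1 + Nat.fib (j + 3) = Tp (x + Nat.fib (j + 2)) by omega]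
          omega
      · rw [if_neg hx] at e ⊢
        rw [show Tp x + 1 + Nat.fib (j + 3) = Tp (x + Nat.fib (j + 2)) + 1 by omega, Tp_a (F_Tp _)]
        push_cast
        omega

lemma shift_T_eq {j n : ℕ} (h : ¬ E j (n + 1)) :
    Tp (n + Nat.fib (j + 2)) = Tp n + Nat.fib (j + 3) := by
  have := shift_T j n
  rw [if_neg h] at this
  omega

/-- Mismatch characterization. -/
lemma mismatch (j n : ℕ) : fibWord n ≠ fibWord (n + Nat.fib (j + 2)) ↔ E j (n + 1) ∨ E j (n + 2) := by
  classical
  have e1 := shift_T j n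
  have e2 := shift_T j (n + 1)
  rw [show n + 1 + Nat.fib (j + 2) = n + Nat.fib (j + 2) + 1 by ring,
    show n + 1 + 1 = n + 2 from rfl] at e2
  have hna : ¬ (E j (n + 1) ∧ E j (n + 2)) := fun h => E_nonadj j _ h.1 h.2
  by_cases h1 : E j (n + 1) <;> by_cases h2 : E j (n + 2)
  · exact absurd ⟨h1, h2⟩ hna
  all_goals
    simp only [h1, h2, if_true, if_false, or_true, or_false, iff_true, iff_false, not_not, ne_eq] at e1 e2 ⊢
    rcases neg_one_pow_eq_or ℤ j with hs | hs <;>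
    cases hA : fibWord n <;> cases hB : fibWord (n + Nat.fib (j + 2)) <;>
      simp only [hA, hB, Tp, hs] at e1 e2 ⊢ <;> push_cast at e1 e2 <;> simp at e1 e2 ⊢ <;> omega

/-! ### Iterates of `Tp` -/

lemma iter_mono (j : ℕ) : StrictMono Tp^[j] := Tp_mono.iterate j

lemma iter_fib (j r : ℕ) : Tp^[j] (Nat.fib (r + 2)) = Nat.fib (r + 2 + j) := by
  induction j with
  | zero => rfl
  | succ j ih =>
    rw [Function.iterate_succ_apply', ih, show r + 2 + j = (r + j) + 2 by ring, T_fib]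
    congr 1
    ring

lemma iter_two (j : ℕ) : Tp^[j] 2 = Nat.fib (j + 3) := by
  have := iter_fib j 1
  rw [show Nat.fib (1 + 2) = 2 from rfl] at this
  rw [this]; congr 1; ring

lemma E_lower {j N : ℕ} (h : E j N) : Nat.fib (j + 3) ≤ N := by
  obtain ⟨m, hm, rfl⟩ := h
  rw [← iter_two]
  have := b_pos hm
  exact (iter_mono j).monotone (by omega)

lemma T_shift {r x : ℕ} (h : x + 1 < Nat.fib (r + 3)) :
    Tp (Nat.fib (r + 2) + x) = Nat.fib (r + 3) + Tp x := by
  have : ¬ E r (x + 1) := fun hE => by have := E_lower hE; omega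
  have := shift_T_eq this
  rw [add_comm, this, add_comm]

lemma F_shift {r x : ℕ} (h : x + 2 < Nat.fib (r + 3)) :
    fibWord (Nat.fib (r + 2) + x) = fibWord x := by
  by_contra hne
  have h1 := (mismatch r x).1 (by rw [add_comm x]; exact fun h => hne h.symm)
  rcases h1 with h1 | h1 <;> have := E_lower h1 <;> omega

lemma iter_shift {r x : ℕ} (j : ℕ) (hr : 1 ≤ r) (h : x ≤ Nat.fib (r + 1)) :
    Tp^[j] (Nat.fib (r + 2) + x) = Nat.fib (r + 2 + j) + Tp^[j] x := by
  induction j with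
  | zero => rfl
  | succ j ih =>
    obtain ⟨s, rfl⟩ : ∃ s, r = s + 1 := ⟨r - 1, by omega⟩
    have h1 := (iter_mono j).monotone h
    rw [show s + 1 + 1 = s + 2 from rfl, iter_fib] at h1
    rw [Function.iterate_succ_apply', ih, Function.iterate_succ_apply',
      show s + 1 + 2 + j = (s + j + 1) + 2 by ring, T_shift]
    · congr 2; ring
    · have h2 : Nat.fib (s + j + 1 + 3) = Nat.fib (s + 2 + j) + Nat.fib (s + j + 3) := by
        rw [show s + j + 1 + 3 = (s + j + 2) + 2 by ring, Nat.fib_add_two,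
          show s + 2 + j = s + j + 2 by ring]
      have h3 : Nat.fib 3 ≤ Nat.fib (s + j + 3) := Nat.fib_mono (by omega)
      rw [show Nat.fib 3 = 2 from rfl] at h3
      omega

lemma E_trans {j N r : ℕ} (h : E j N) (hN : N ≤ Nat.fib (r + 1)) : E j (Nat.fib (r + 2) + N) := by
  have hl := E_lower h
  have hr : j + 2 ≤ r := by
    by_contra hc
    have h1 : Nat.fib (r + 1) ≤ Nat.fib (j + 2) := Nat.fib_mono (by omega)
    have h2 : Nat.fib (j + 2) < Nat.fib (j + 2 + 1) := Nat.fib_lt_fib_succ (by omega)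
    rw [show j + 2 + 1 = j + 3 from rfl] at h2
    omega
  obtain ⟨s, rfl⟩ : ∃ s, r = s + 2 + j := ⟨r - 2 - j, by omega⟩
  obtain ⟨m, hm, rfl⟩ := h
  have h1 : m + 1 ≤ Nat.fib (s + 3) := by
    rw [show s + 2 + j + 1 = s + 1 + 2 + j by ring, ← iter_fib] at hN
    exact (iter_mono j).le_iff_le.1 hN
  refine ⟨Nat.fib (s + 4) + m, ?_, ?_⟩
  · rw [F_shift (r := s + 2), hm]
    have h2 : Nat.fib (s + 2 + 3) = Nat.fib (s + 3) + Nat.fib (s + 4) := Nat.fib_add_two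
    have h3 : Nat.fib 3 ≤ Nat.fib (s + 4) := Nat.fib_mono (by omega)
    rw [show Nat.fib 3 = 2 from rfl] at h3
    omega
  · have := iter_shift (r := s + 2) j (by omega) h1
    rw [show Nat.fib (s + 4) + m + 1 = Nat.fib (s + 2 + 2) + (m + 1) by ring, this]
    congr 2; ring

/-- `B j H`: at `H` there begin blocks `σ^j(aab)`. -/
def B (j H : ℕ) : Prop := ∃ x, fibWord x = false ∧ fibWord (x + 1) = false ∧
  fibWord (x + 2) = true ∧ H = Tp^[j] x

lemma B_fib (j : ℕ) : B j (Nat.fib (j + 3)) := ⟨2, F2, F3, F4, (iter_two j).symm⟩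

lemma B_trans {j N r : ℕ} (h : B j N) (hN : N < Nat.fib (r + 1)) : B j (Nat.fib (r + 2) + N) := by
  obtain ⟨x, h0, h1, h2, rfl⟩ := h
  have hx : 2 ≤ x := by
    by_contra hc
    have : x = 0 ∨ x = 1 := by omega
    rcases this with rfl | rfl
    · rw [show 0 + 1 = 1 from rfl, F1] at h1; cases h1
    · rw [F1] at h0; cases h0
  have hl : Nat.fib (j + 3) ≤ Tp^[j] x := by
    rw [← iter_two]
    exact (iter_mono j).monotone hx
  have hr : j + 3 ≤ r := by
    by_contra hc
    have h1 : Nat.fib (r + 1) ≤ Nat.fib (j + 3) := Nat.fib_mono (by omega)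
    omega
  obtain ⟨s, rfl⟩ : ∃ s, r = s + 3 + j := ⟨r - 3 - j, by omega⟩
  have hx1 : x < Nat.fib (s + 4) := by
    rw [show s + 3 + j + 1 = s + 2 + 2 + j by ring, ← iter_fib] at hN
    exact (iter_mono j).lt_iff_lt.1 hN
  have hf2 : Nat.fib (s + 3 + 3) = Nat.fib (s + 4) + Nat.fib (s + 5) := Nat.fib_add_two
  have hf3 : Nat.fib 5 ≤ Nat.fib (s + 5) := Nat.fib_mono (by omega)
  rw [show Nat.fib 5 = 5 from rfl] at hf3
  refine ⟨Nat.fib (s + 5) + x, ?_, ?_, ?_, ?_⟩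
  · rw [F_shift (r := s + 3) (by omega), h0]
  · rw [add_assoc, F_shift (r := s + 3) (by omega), h1]
  · rw [add_assoc, F_shift (r := s + 3) (by omega), h2]
  · have := iter_shift (r := s + 3) j (by omega) hx1.le
    rw [show s + 5 = s + 3 + 2 by ring, this]
    congr 2; ring

lemma iter_step (j x : ℕ) : Tp^[j] (x + 1) = Tp^[j] x +
    (if fibWord x then Nat.fib (j + 1) else Nat.fib (j + 2)) := by
  induction j generalizing x with
  | zero => simp
  | succ j ih =>
    rw [Function.iterate_succ_apply, Function.iterate_succ_apply]
    cases h : fibWord x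
    · have hf : Nat.fib (j + 1 + 2) = Nat.fib (j + 1) + Nat.fib (j + 2) := Nat.fib_add_two
      rw [Tp_a h, ih, ih, F_Tp, F_Tp_a h]
      simp [hf]
      ring
    · rw [Tp_b h, ih, F_Tp]
      simp

lemma B_cube {j H I : ℕ} (hB : B j H) (h1 : H < I) (h2 : I < H + Nat.fib (j + 1)) (t : ℕ)
    (ht : t < 2 * Nat.fib (j + 2)) :
    fibWord (I - 1 + t) = fibWord (I - 1 + t + Nat.fib (j + 2)) := by
  obtain ⟨x, ha, hb, hc, rfl⟩ := hB
  have main : ∀ e, E j e → Tp^[j] x < e → Tp^[j] x + 2 * Nat.fib (j + 2) + Nat.fib (j + 1) ≤ e := by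
    rintro e ⟨m, hm, rfl⟩ he
    have h3 := (iter_mono j).lt_iff_lt.1 he
    have h4 : x + 3 ≤ m + 1 := by
      have n0 : m ≠ x := by rintro rfl; rw [ha] at hm; cases hm
      have n1 : m ≠ x + 1 := by rintro rfl; rw [hb] at hm; cases hm
      omega
    have h5 := (iter_mono j).monotone h4
    have e1 := iter_step j x
    have e2 := iter_step j (x + 1)
    have e3 := iter_step j (x + 2)
    rw [ha] at e1
    rw [hb, show x + 1 + 1 = x + 2 from rfl] at e2
    rw [hc, show x + 2 + 1 = x + 3 from rfl] at e3
    simp at e1 e2 e3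
    omega
  by_contra hne
  rcases (mismatch j _).1 hne with h | h
  · have := main _ h (by omega)
    omega
  · have := main _ h (by omega)
    omega

/-! ### The exceptional positions -/

lemma E_fib (j s : ℕ) : E j (Nat.fib (j + 3 + 2 * s)) := by
  induction s with
  | zero => exact ⟨1, F1, (iter_two j).symm⟩
  | succ s ih =>
    have := E_trans (r := j + 2 + 2 * s) ih (by
      apply le_of_eq; congr 1; ring)
    rw [show j + 3 + 2 * (s + 1) = (j + 3 + 2 * s) + 2 by ring, Nat.fib_add_two, add_comm]
    rwa [show j + 2 + 2 * s + 2 = j + 3 + 2 * s + 1 by ring] at this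

lemma E_chain {j N l : ℕ} (h : E j N) (hN : N ≤ Nat.fib (l + 1)) (t M : ℕ)
    (hM : M + Nat.fib (l + 1) = N + Nat.fib (l + 1 + 2 * t)) : E j M := by
  induction t generalizing M with
  | zero =>
    rw [show l + 1 + 2 * 0 = l + 1 by ring] at hM
    have : M = N := by omega
    rwa [this]
  | succ t ih =>
    have hf : Nat.fib (l + 1 + 2 * (t + 1)) = Nat.fib (l + 1 + 2 * t) + Nat.fib (l + 2 * t + 2) := by
      rw [show l + 1 + 2 * (t + 1) = (l + 1 + 2 * t) + 2 by ring, Nat.fib_add_two]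
      congr 2; ring
    have hm : Nat.fib (l + 1) ≤ Nat.fib (l + 1 + 2 * t) := Nat.fib_mono (by omega)
    rw [hf] at hM
    have h1 := ih (N + Nat.fib (l + 1 + 2 * t) - Nat.fib (l + 1)) (by omega)
    have h2 := E_trans (r := l + 2 * t) h1 (by
      rw [show l + 2 * t + 1 = l + 1 + 2 * t by ring]; omega)
    convert h2 using 1
    omega

lemma chain_E {I l t : ℕ} (hI : I + Nat.fib (l + 1) = Nat.fib (l + 2 * t + 3)) (j : ℕ) :
    ∃ e, E j e ∧ I ≤ e ∧ e ≤ I + 2 * Nat.fib (j + 2) := by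
  have hf : Nat.fib (j + 3) = Nat.fib (j + 1) + Nat.fib (j + 2) := Nat.fib_add_two
  have hf0 : Nat.fib (j + 2) = Nat.fib j + Nat.fib (j + 1) := Nat.fib_add_two
  rcases Nat.lt_or_ge j (l + 2 * t) with hj | hj
  swap
  · refine ⟨_, E_fib j 0, ?_, ?_⟩
    · have : Nat.fib (l + 2 * t + 3) ≤ Nat.fib (j + 3 + 2 * 0) := Nat.fib_mono (by omega)
      omega
    · rw [show j + 3 + 2 * 0 = j + 3 by ring]
      omega
  · rcases Nat.even_or_odd' (l + 2 * t - j) with ⟨s, hs | hs⟩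
    · rcases Nat.lt_or_ge (j + 2) l with hl | hl
      · refine ⟨I + Nat.fib (j + 3), ?_, by omega, by omega⟩
        refine E_chain (E_fib j 0) (l := l) (Nat.fib_mono (by omega)) (t + 1) _ ?_
        rw [show j + 3 + 2 * 0 = j + 3 by ring, show l + 1 + 2 * (t + 1) = l + 2 * t + 3 by ring]
        omega
      · refine ⟨_, E_fib j s, ?_, ?_⟩ <;> rw [show j + 3 + 2 * s = l + 2 * t + 3 by omega]
        · omega
        · have : Nat.fib (l + 1) ≤ Nat.fib (j + 3) := Nat.fib_mono (by omega)
          omega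
    · rcases Nat.lt_or_ge j l with hl | hl
      · refine ⟨I, ?_, le_rfl, by omega⟩
        refine E_chain (E_fib j (s - t)) (l := l + 2) (Nat.fib_mono (by omega)) t _ ?_
        rw [show j + 3 + 2 * (s - t) = l + 2 by omega, show l + 2 + 1 + 2 * t = l + 2 * t + 3 by ring]
        have : Nat.fib (l + 2 + 1) = Nat.fib (l + 1) + Nat.fib (l + 2) := Nat.fib_add_two
        omega
      · refine ⟨_, E_trans (r := l + 2 * t + 1) (E_fib j 0) (Nat.fib_mono (by omega)), ?_, ?_⟩
        · rw [show l + 2 * t + 1 + 2 = l + 2 * t + 3 by ring]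
          omega
        · rw [show l + 2 * t + 1 + 2 = l + 2 * t + 3 by ring, show j + 3 + 2 * 0 = j + 3 by ring]
          have : Nat.fib (l + 1) ≤ Nat.fib j := Nat.fib_mono (by omega)
          omega

/-- The exceptional positions in `[f_r, f_{r+1})`. -/
def Cset : ℕ → Finset ℕ
  | 0 => {1}
  | 1 => {2}
  | r + 2 => insert (Nat.fib (r + 4)) ((Cset r).image (fun x => Nat.fib (r + 4) + x))

lemma Cset_bd (r : ℕ) : ∀ I ∈ Cset r, Nat.fib (r + 2) ≤ I ∧ I < Nat.fib (r + 3) := by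
  induction r using Nat.strong_induction_on with
  | _ r ih =>
    match r with
    | 0 => intro I hI; simp [Cset] at hI; subst hI; decide
    | 1 => intro I hI; simp [Cset] at hI; subst hI; decide
    | r + 2 =>
      intro I hI
      have hf : Nat.fib (r + 5) = Nat.fib (r + 3) + Nat.fib (r + 4) := Nat.fib_add_two
      have hp : 0 < Nat.fib (r + 3) := Nat.fib_pos.2 (by omega)
      rw [show r + 2 + 2 = r + 4 from rfl, show r + 2 + 3 = r + 5 from rfl]
      simp only [Cset, Finset.mem_insert, Finset.mem_image] at hI
      rcases hI with rfl | ⟨x, hx, rfl⟩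
      · omega
      · have := ih r (by omega) x hx
        omega

lemma Cset_card (r : ℕ) : (Cset r).card = r / 2 + 1 := by
  induction r using Nat.strong_induction_on with
  | _ r ih =>
    match r with
    | 0 => rfl
    | 1 => rfl
    | r + 2 =>
      have h := ih r (by omega)
      rw [Cset, Finset.card_insert_of_notMem, Finset.card_image_of_injective, h]
      · omega
      · intro a b hab; simpa using hab
      · simp only [Finset.mem_image, not_exists, not_and]
        intro x hx
        have := (Cset_bd r x hx).1
        have : 0 < Nat.fib (r + 2) := Nat.fib_pos.2 (by omega)
        omega

lemma Cset_form (r : ℕ) : ∀ I ∈ Cset r, ∃ l t, r = l + 2 * t ∧ I + Nat.fib (l + 1) = Nat.fib (r + 3) := by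
  induction r using Nat.strong_induction_on with
  | _ r ih =>
    match r with
    | 0 => intro I hI; simp [Cset] at hI; subst hI; exact ⟨0, 0, rfl, rfl⟩
    | 1 => intro I hI; simp [Cset] at hI; subst hI; exact ⟨1, 0, rfl, rfl⟩
    | r + 2 =>
      intro I hI
      have hf : Nat.fib (r + 5) = Nat.fib (r + 3) + Nat.fib (r + 4) := Nat.fib_add_two
      rw [show r + 2 + 3 = r + 5 from rfl]
      simp only [Cset, Finset.mem_insert, Finset.mem_image] at hI
      rcases hI with rfl | ⟨x, hx, rfl⟩
      · exact ⟨r + 2, 0, by ring, by rw [show r + 2 + 1 = r + 3 from rfl]; omega⟩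
      · obtain ⟨l, t, h1, h2⟩ := ih r (by omega) x hx
        exact ⟨l, t + 1, by omega, by omega⟩

lemma fib_mem_Cset (r : ℕ) : Nat.fib (r + 2) ∈ Cset r := by
  match r with
  | 0 => decide
  | 1 => decide
  | r + 2 => simp [Cset]

lemma exists_fib_between (I : ℕ) (h : 1 ≤ I) : ∃ r, Nat.fib (r + 2) ≤ I ∧ I < Nat.fib (r + 3) := by
  induction I, h using Nat.le_induction with
  | base => exact ⟨0, by decide⟩
  | succ I _ ih =>
    obtain ⟨r, h1, h2⟩ := ih
    rcases Nat.lt_or_ge (I + 1) (Nat.fib (r + 3)) with h | h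
    · exact ⟨r, by omega, h⟩
    · have : Nat.fib (r + 3) < Nat.fib (r + 3 + 1) := Nat.fib_lt_fib_succ (by omega)
      exact ⟨r + 1, h, by rw [show r + 1 + 3 = r + 3 + 1 from rfl]; omega⟩

lemma dichotomy (I : ℕ) (hI : 1 ≤ I) : (∃ r, I ∈ Cset r) ∨
    ∃ j H, B j H ∧ H < I ∧ I < H + Nat.fib (j + 1) := by
  induction I using Nat.strong_induction_on with
  | _ I ih =>
    obtain ⟨r, h1, h2⟩ := exists_fib_between I hI
    obtain ⟨I', rfl⟩ : ∃ x, I = Nat.fib (r + 2) + x := ⟨I - Nat.fib (r + 2), by omega⟩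
    have hf : Nat.fib (r + 3) = Nat.fib (r + 1) + Nat.fib (r + 2) := Nat.fib_add_two
    have hp : 0 < Nat.fib (r + 2) := Nat.fib_pos.2 (by omega)
    rcases Nat.eq_zero_or_pos I' with h0 | h0
    · left; exact ⟨r, by rw [h0]; exact fib_mem_Cset r⟩
    · rcases ih I' (by omega) h0 with ⟨r', hr'⟩ | ⟨j, H, hB, h3, h4⟩
      · have hb := Cset_bd r' I' hr'
        have hlt : r' + 2 < r + 1 := by
          by_contra hc
          have : Nat.fib (r + 1) ≤ Nat.fib (r' + 2) := Nat.fib_mono (by omega)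
          omega
        rcases Nat.lt_or_ge (r' + 2) r with h5 | h5
        · right
          obtain ⟨j, rfl⟩ : ∃ j, r = j + 1 := ⟨r - 1, by omega⟩
          refine ⟨j, _, B_fib j, ?_, ?_⟩
          · rw [show j + 1 + 2 = j + 3 from rfl]; omega
          · have : Nat.fib (r' + 3) ≤ Nat.fib (j + 1) := Nat.fib_mono (by omega)
            rw [show j + 1 + 2 = j + 3 from rfl]
            omega
        · left
          have : r = r' + 2 := by omega
          subst this
          refine ⟨r' + 2, ?_⟩
          simp only [Cset, Finset.mem_insert, Finset.mem_image]
          exact Or.inr ⟨I', hr', rfl⟩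
      · right
        exact ⟨j, _, B_trans (r := r) hB (by omega), by omega, by omega⟩

/-! ### Periods of cubes are Fibonacci numbers -/

lemma period_fib (p : ℕ) (hp : 1 ≤ p) : ∀ i, (∀ t, t + 1 < 2 * p → fibWord (i + t) = fibWord (i + t + p)) →
    ∃ j, p = Nat.fib (j + 2) ∧ Tp (i + p) = Tp i + Nat.fib (j + 3) := by
  induction p using Nat.strong_induction_on with
  | _ p ih =>
    have main : ∀ i, fibWord i = false →
        (∀ t, t + 1 < 2 * p → fibWord (i + t) = fibWord (i + t + p)) →
        ∃ j, p = Nat.fib (j + 2) ∧ Tp (i + p) = Tp i + Nat.fib (j + 3) := by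
      intro i hi h
      rcases Nat.eq_or_lt_of_le hp with h1 | h1
      · subst h1
        refine ⟨0, rfl, ?_⟩
        rw [Tp_a hi]; rfl
      · have hip : fibWord (i + p) = false := by
          have := h 0 (by omega)
          rw [add_zero, hi] at this
          exact this.symm
        obtain ⟨n, rfl⟩ := a_is_Tp hi
        obtain ⟨n2, hn2⟩ := a_is_Tp hip
        have hlt : n < n2 := Tp_mono.lt_iff_lt.1 (by omega)
        obtain ⟨q, rfl⟩ : ∃ q, n2 = n + q := ⟨n2 - n, by omega⟩
        have hF : ∀ k, Tp (n + k) + 2 < Tp n + 2 * p → Tp (n + k + q) = Tp (n + k) + p →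
            fibWord (n + k) = fibWord (n + k + q) := by
          intro k hk hT
          have hm := Tp_mono.monotone (show n ≤ n + k by omega)
          have h2 := h (Tp (n + k) - Tp n + 1) (by omega)
          rw [show Tp n + (Tp (n + k) - Tp n + 1) = Tp (n + k) + 1 by omega,
            show Tp (n + k) + 1 + p = Tp (n + k + q) + 1 by omega] at h2
          have aux : ∀ y, fibWord (Tp y + 1) = !fibWord y := by
            intro y
            cases hy : fibWord y
            · exact F_Tp_a hy
            · rw [← Tp_b hy, F_Tp]; rfl
          rw [aux, aux] at h2
          simpa using h2
        have hT : ∀ k, k + 1 ≤ 2 * q → Tp (n + k + q) = Tp (n + k) + p ∧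
            (k + 1 < 2 * q → fibWord (n + k) = fibWord (n + k + q)) := by
          intro k
          induction k using Nat.strong_induction_on with
          | _ k ihk =>
            intro hk
            have e : Tp (n + k + q) = Tp (n + k) + p := by
              cases k with
              | zero => exact hn2.symm
              | succ k =>
                obtain ⟨e1, e2⟩ := ihk k (by omega) (by omega)
                have e3 := e2 (by omega)
                rw [show n + (k + 1) + q = n + k + q + 1 by ring, ← add_assoc, Tp, Tp, e1, e3]
                ring
            refine ⟨e, fun hk2 => hF k ?_ e⟩
            rcases Nat.lt_or_ge k q with hkq | hkq
            · have := Tp_mono (show n + k < n + q by omega)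
              omega
            · obtain ⟨k', rfl⟩ : ∃ k', k = k' + q := ⟨k - q, by omega⟩
              have e1 := (ihk k' (by omega) (by omega)).1
              rw [← add_assoc, e1]
              have := Tp_two (n + k')
              have := Tp_mono.monotone (show n + k' + 2 ≤ n + q by omega)
              omega
        have hqp : q < p := by
          rcases Nat.lt_or_ge q 2 with h2 | h2
          · omega
          · have e1 := Tp_two n
            have e2 : ∀ d, Tp (n + 2) + d ≤ Tp (n + 2 + d) := by
              intro d
              induction d with
              | zero => exact le_rfl
              | succ d ihd =>
                have := Tp_mono (show n + 2 + d < n + 2 + (d + 1) by omega)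
                omega
            have e3 := e2 (q - 2)
            rw [show n + 2 + (q - 2) = n + q by omega] at e3
            omega
        obtain ⟨j, hj1, hj2⟩ := ih q hqp (by omega) n (fun t ht => (hT t (by omega)).2 ht)
        refine ⟨j + 1, ?_, ?_⟩
        · rw [show j + 1 + 2 = j + 3 from rfl]; omega
        · have hf : Nat.fib (j + 1 + 3) = Nat.fib (j + 2) + Nat.fib (j + 3) := Nat.fib_add_two
          rw [hn2, Tp_Tp, Tp_Tp]
          omega
    intro i h
    cases hi : fibWord i
    · exact main i hi h
    · have hpos := b_pos hi
      obtain ⟨i', rfl⟩ : ∃ i', i = i' + 1 := ⟨i - 1, by omega⟩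
      have hip : fibWord (i' + p + 1) = true := by
        have := h 0 (by omega)
        rw [add_zero, hi] at this
        rw [this]; congr 1; ring
      have h1 := b_prev hi
      have h2 := b_prev hip
      obtain ⟨j, hj1, hj2⟩ := main i' h1 (by
        intro t ht
        cases t with
        | zero => rw [add_zero, h1, h2]
        | succ t =>
          have := h t (by omega)
          rw [show i' + (t + 1) = i' + 1 + t by ring]
          exact this)
      refine ⟨j, hj1, ?_⟩
      rw [show i' + 1 + p = i' + p + 1 by ring, Tp_a h1, Tp_a h2, hj2]
      ring

/-! ### Cubes -/

lemma cube_iff (i : ℕ) : (∃ w : List Bool, w ≠ [] ∧ fFactor i (3 * w.length) = w ++ w ++ w) ↔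
    ∃ p, 1 ≤ p ∧ ∀ t, t < 2 * p → fibWord (i - 1 + t) = fibWord (i - 1 + t + p) := by
  constructor
  · rintro ⟨w, hw, h⟩
    have hp : 1 ≤ w.length := List.length_pos_of_ne_nil hw
    refine ⟨w.length, hp, fun t ht => ?_⟩
    have get : ∀ s, s < 3 * w.length → fibWord (i - 1 + s) = (w ++ w ++ w).getD s false := by
      intro s hs
      rw [← h]
      simp [fFactor, hs]
    have e1 := get t (by omega)
    have e2 := get (t + w.length) (by omega)
    rw [add_assoc, e1, e2]
    rw [List.append_assoc, List.getD_append_right w (w ++ w) _ (t + w.length) (by omega),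
      ← List.append_assoc, List.getD_append (w ++ w) w _ t (by simp; omega)]
    simp
  · rintro ⟨p, hp, h⟩
    have hl : (fFactor i p).length = p := by simp [fFactor]
    refine ⟨fFactor i p, ?_, ?_⟩
    · intro h0
      rw [h0] at hl
      simp at hl
      omega
    · rw [hl]
      apply List.ext_getElem
      · simp [fFactor]; omega
      · intro s h1 h2
        have hs : s < 3 * p := by simpa [fFactor] using h1
        have a1 := fun t ht => (h t ht).symm
        simp only [List.getElem_append, List.length_append, hl]
        split_ifs with c1 c2
        · simp [fFactor]
        · simp only [fFactor, List.getElem_map, List.getElem_range]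
          rw [h (s - p) (by omega)]
          congr 1; omega
        · simp only [fFactor, List.getElem_map, List.getElem_range]
          rw [h (s - (p + p)) (by omega)]
          rw [show i - 1 + (s - (p + p)) + p = i - 1 + (s - p) by omega, h (s - p) (by omega)]
          congr 1; omega

lemma cube_iff_not_chain (i : ℕ) (hi : 1 ≤ i) :
    (∃ w : List Bool, w ≠ [] ∧ fFactor i (3 * w.length) = w ++ w ++ w) ↔ ¬ ∃ r, i ∈ Cset r := by
  rw [cube_iff]
  constructor
  · rintro ⟨p, hp, h⟩ ⟨r, hr⟩
    obtain ⟨j, rfl, _⟩ := period_fib p hp (i - 1) (fun t ht => h t (by omega))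
    obtain ⟨l, t, rfl, hI⟩ := Cset_form r i hr
    obtain ⟨e, hE, h1, h2⟩ := chain_E hI j
    rcases Nat.lt_or_ge e (i + 2 * Nat.fib (j + 2)) with h3 | h3
    · refine (mismatch j (i - 1 + (e - i))).2 (Or.inl ?_) (h (e - i) (by omega))
      rwa [show i - 1 + (e - i) + 1 = e by omega]
    · refine (mismatch j (i - 1 + (2 * Nat.fib (j + 2) - 1))).2 (Or.inr ?_) (h _ (by omega))
      rwa [show i - 1 + (2 * Nat.fib (j + 2) - 1) + 2 = e by omega]
  · intro h
    rcases dichotomy i hi with h1 | ⟨j, H, hB, h1, h2⟩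
    · exact absurd h1 h
    · exact ⟨Nat.fib (j + 2), Nat.fib_pos.2 (by omega), fun t ht => B_cube hB h1 h2 t ht⟩

/-! ### Counting -/

/-- Exceptional positions below `f_m`. -/
def Sset : ℕ → Finset ℕ
  | 0 => ∅
  | m + 1 => Sset m ∪ Cset m

lemma mem_Sset (m i : ℕ) : i ∈ Sset m ↔ ∃ r < m, i ∈ Cset r := by
  induction m with
  | zero => simp [Sset]
  | succ m ih =>
    simp only [Sset, Finset.mem_union, ih]
    constructor
    · rintro (⟨r, hr, h⟩ | h)
      · exact ⟨r, by omega, h⟩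
      · exact ⟨m, by omega, h⟩
    · rintro ⟨r, hr, h⟩
      rcases Nat.lt_or_ge r m with h1 | h1
      · exact Or.inl ⟨r, h1, h⟩
      · right
        rwa [show m = r by omega]

lemma Sset_lt (m i : ℕ) (h : i ∈ Sset m) : 1 ≤ i ∧ i < Nat.fib (m + 2) := by
  obtain ⟨r, hr, h⟩ := (mem_Sset m i).1 h
  have h1 := Cset_bd r i h
  have h2 : Nat.fib (r + 3) ≤ Nat.fib (m + 2) := Nat.fib_mono (by omega)
  have : 0 < Nat.fib (r + 2) := Nat.fib_pos.2 (by omega)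
  omega

lemma Sset_card_succ (m : ℕ) : (Sset (m + 1)).card = (Sset m).card + (m / 2 + 1) := by
  rw [Sset, Finset.card_union_of_disjoint, Cset_card]
  rw [Finset.disjoint_left]
  intro i h1 h2
  have := Sset_lt m i h1
  have := Cset_bd m i h2
  omega

lemma Sset_card (k : ℕ) : (Sset (2 * k)).card = k ^ 2 + k := by
  induction k with
  | zero => rfl
  | succ k ih =>
    rw [show 2 * (k + 1) = 2 * k + 1 + 1 by ring, Sset_card_succ, Sset_card_succ, ih,
      show (2 * k + 1) / 2 = k by omega, show 2 * k / 2 = k by omega]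
    ring

lemma count (m : ℕ) : (({i : ℕ | 1 ≤ i ∧ i ≤ fn m ∧
    ∃ w : List Bool, w ≠ [] ∧ fFactor i (3 * w.length) = w ++ w ++ w}.ncard : ℤ)
      = (fn m : ℤ) - (Sset m).card - 1) := by
  have hfn : fn m = Nat.fib (m + 2) := rfl
  have hset : {i : ℕ | 1 ≤ i ∧ i ≤ fn m ∧
      ∃ w : List Bool, w ≠ [] ∧ fFactor i (3 * w.length) = w ++ w ++ w} =
      ((Finset.Icc 1 (fn m) \ insert (fn m) (Sset m) : Finset ℕ) : Set ℕ) := by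
    ext i
    simp only [Set.mem_ofPred_eq, Finset.coe_sdiff, Set.mem_sdiff, Finset.mem_coe, Finset.mem_Icc,
      Finset.mem_insert]
    constructor
    · rintro ⟨h1, h2, h3⟩
      have h4 := (cube_iff_not_chain i h1).1 h3
      refine ⟨⟨h1, h2⟩, ?_⟩
      rintro (h5 | h5)
      · exact h4 ⟨m, by rw [h5, hfn]; exact fib_mem_Cset m⟩
      · obtain ⟨r, _, h⟩ := (mem_Sset m i).1 h5
        exact h4 ⟨r, h⟩
    · rintro ⟨⟨h1, h2⟩, h3⟩
      refine ⟨h1, h2, (cube_iff_not_chain i h1).2 ?_⟩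
      rintro ⟨r, hr⟩
      apply h3
      rcases Nat.lt_or_ge r m with h | h
      · exact Or.inr ((mem_Sset m i).2 ⟨r, h, hr⟩)
      · left
        have := (Cset_bd r i hr).1
        have : Nat.fib (m + 2) ≤ Nat.fib (r + 2) := Nat.fib_mono (by omega)
        omega
  rw [hset, Set.ncard_coe_finset]
  have hpos : 0 < Nat.fib (m + 2) := Nat.fib_pos.2 (by omega)
  have hsub : insert (fn m) (Sset m) ⊆ Finset.Icc 1 (fn m) := by
    intro i hi
    rw [Finset.mem_insert] at hi
    rw [Finset.mem_Icc]
    rcases hi with h | h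
    · omega
    · have := Sset_lt m i h
      omega
  have hc := Finset.card_le_card hsub
  rw [Finset.card_sdiff_of_subset hsub]
  rw [Finset.card_insert_of_notMem (fun h => by have := Sset_lt m _ h; omega), Nat.card_Icc] at *
  omega

/-- The number of positions `1 ≤ i ≤ f_m` at which a cube begins in the Fibonacci word
equals `f_{2k} - k² - k - 1` if `m = 2k` and `f_{2k+1} - k² - 2k - 2` if `m = 2k+1`. -/
theorem number_of_positions_starting_a_cube (m k : ℕ) :
    (m = 2 * k →
      (({i : ℕ | 1 ≤ i ∧ i ≤ fn m ∧
          ∃ w : List Bool, w ≠ [] ∧ fFactor i (3 * w.length) = w ++ w ++ w}.ncard : ℤ)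
        = (fn m : ℤ) - (k : ℤ) ^ 2 - (k : ℤ) - 1)) ∧
    (m = 2 * k + 1 →
      (({i : ℕ | 1 ≤ i ∧ i ≤ fn m ∧
          ∃ w : List Bool, w ≠ [] ∧ fFactor i (3 * w.length) = w ++ w ++ w}.ncard : ℤ)
        = (fn m : ℤ) - (k : ℤ) ^ 2 - 2 * (k : ℤ) - 2)) := by
  refine ⟨?_, ?_⟩
  · rintro rfl
    rw [count, Sset_card]
    push_cast
    ring
  · rintro rfl
    rw [count, Sset_card_succ, Sset_card, show 2 * k / 2 = k by omega]
    push_cast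
    ring
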